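/- Logarithmic asymptotics for the critical kernel integrals: let n = 1 or n = 3 and let g ∈ C¹(ℝ/ℤ; ℝ³). There exist constants C > 0 and ε₀ > 0, depending only on n, c_Γ, and κ_max, such that for all 0 < ε < ε₀, 0 < δ < ε₀, every s ∈ ℝ/ℤ and θ ∈ [0,2π), |∫_{−1/2}^{1/2} s̄^{n−1}/(|R(s,s̄,θ)|² + δ²)^{n/2} g(s̄) ds̄ − ∫_{−1/2}^{1/2} ( s̄^{n−1}/|X̄(s,s̄)|^n g(s̄) − g(0)/|s̄| ) ds̄ + g(0) log(ε² + δ²) + (n−1) g(0)| ≤ C ‖g‖_{C¹} (ε² + δ²)^{1/2} |log(ε² + δ²)|. -/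

import Mathlib

open MeasureTheory

noncomputable section

local notation "⟪" x ", " y "⟫" => @inner ℝ _ _ x y

abbrev V3 : Type := EuclideanSpace ℝ (Fin 3)

/-- The `C⁰` (sup) norm of a function `ℝ/ℤ → ℝ³`. -/
def C0norm (f : ℝ → V3) : ℝ := ⨆ s : ℝ, ‖f s‖

/-- The `C¹` norm of a function `ℝ/ℤ → ℝ³`. -/
def C1norm (f : ℝ → V3) : ℝ := C0norm f + C0norm (deriv f)

/-- The radial unit vector `e_ρ(s,θ) = cos θ e_{n1}(s) + sin θ e_{n2}(s)`. -/
def ePerp (en1 en2 : ℝ → V3) (s θ : ℝ) : V3 :=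
  Real.cos θ • en1 s + Real.sin θ • en2 s

/-- `R(s, s̄, θ) = X(s) + ε e_ρ(s,θ) − X(s − s̄)`. -/
def Rvec (X en1 en2 : ℝ → V3) (ε s sb θ : ℝ) : V3 :=
  X s + ε • ePerp en1 en2 s θ - X (s - sb)

/-- The slender-body geometry hypotheses: `X : ℝ/ℤ → ℝ³` is a `C²` closed curve
parameterized by arclength, non-self-intersecting with constant `cΓ`, with curvature
bounded by `κmax`, together with a `C¹` orthonormal frame `(X', en1, en2)`. -/
structure SlenderGeom (cΓ κmax : ℝ) (X en1 en2 : ℝ → V3) : Prop where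
  smooth : ContDiff ℝ 2 X
  periodicX : ∀ s, X (s + 1) = X s
  arclength : ∀ s, ‖deriv X s‖ = 1
  no_self_intersect : ∀ s t : ℝ, |s - t| ≤ 1 / 2 → cΓ * |s - t| ≤ ‖X s - X t‖
  curvature_max : ∀ s, ‖deriv (deriv X) s‖ ≤ κmax
  en1_smooth : ContDiff ℝ 1 en1
  en2_smooth : ContDiff ℝ 1 en2
  en1_periodic : ∀ s, en1 (s + 1) = en1 s
  en2_periodic : ∀ s, en2 (s + 1) = en2 s
  en1_unit : ∀ s, ‖en1 s‖ = 1
  en2_unit : ∀ s, ‖en2 s‖ = 1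
  es_en1 : ∀ s, ⟪deriv X s, en1 s⟫ = 0
  es_en2 : ∀ s, ⟪deriv X s, en2 s⟫ = 0
  en1_en2 : ∀ s, ⟪en1 s, en2 s⟫ = 0

/-- The singular Stokeslet `S(y) v = v/|y| + (y·v) y/|y|³`. -/
def stokeslet (y v : V3) : V3 := ‖y‖⁻¹ • v + (‖y‖ ^ 3)⁻¹ • ⟪y, v⟫ • y

/-- The singular doublet `D(y) v = v/|y|³ − 3 (y·v) y/|y|⁵`. -/
def doubletK (y v : V3) : V3 := (‖y‖ ^ 3)⁻¹ • v - (3 * (‖y‖ ^ 5)⁻¹) • ⟪y, v⟫ • y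

/-- The regularized Stokeslet `S_δ(y) v`. -/
def stokesletReg (δ : ℝ) (y v : V3) : V3 :=
  ((‖y‖ ^ 2 + δ ^ 2) ^ ((1 : ℝ) / 2))⁻¹ • v
    + ((‖y‖ ^ 2 + δ ^ 2) ^ ((3 : ℝ) / 2))⁻¹ • (⟪y, v⟫ • y + δ ^ 2 • v)

/-- The regularized doublet `D_δ(y) v`. -/
def doubletReg (δ : ℝ) (y v : V3) : V3 :=
  ((‖y‖ ^ 2 + δ ^ 2) ^ ((3 : ℝ) / 2))⁻¹ • v
    - (3 * ((‖y‖ ^ 2 + δ ^ 2) ^ ((5 : ℝ) / 2))⁻¹) • (⟪y, v⟫ • y + δ ^ 2 • v)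

/-- The classical slender-body velocity `u^SB(x)` with doublet coefficient `ε²/2`. -/
def uSB (X f : ℝ → V3) (ε : ℝ) (x : V3) : V3 :=
  (8 * Real.pi)⁻¹ • ∫ t in (0:ℝ)..1,
    (stokeslet (x - X t) (f t) + (ε ^ 2 / 2) • doubletK (x - X t) (f t))

/-- The regularized slender-body velocity with doublet coefficient `β`. -/
def uReg (X f : ℝ → V3) (β δ : ℝ) (x : V3) : V3 :=
  (8 * Real.pi)⁻¹ • ∫ t in (0:ℝ)..1,
    (stokesletReg δ (x - X t) (f t) + β • doubletReg δ (x - X t) (f t))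

/-- The Keller–Rubinow classical centerline velocity `u^SB_C(X(s))`. -/
def uSBC (X f : ℝ → V3) (ε s : ℝ) : V3 :=
  (8 * Real.pi)⁻¹ •
    ((f s - (3 : ℝ) • ⟪deriv X s, f s⟫ • deriv X s
        - (2 * Real.log (Real.pi * ε / 4)) • (f s + ⟪deriv X s, f s⟫ • deriv X s))
      + ∫ t in (0:ℝ)..1,
          ((‖X s - X t‖⁻¹ • f t
              + (‖X s - X t‖ ^ 3)⁻¹ • ⟪X s - X t, f t⟫ • (X s - X t))
            - |Real.sin (Real.pi * (s - t)) / Real.pi|⁻¹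
                • (f s + ⟪deriv X s, f s⟫ • deriv X s)))

/-- The regularized pressure `p^δ(x)`. -/
def pReg (X f : ℝ → V3) (δ : ℝ) (x : V3) : ℝ :=
  (4 * Real.pi)⁻¹ * ∫ t in (0:ℝ)..1,
    (⟪x - X t, f t⟫ * ((‖x - X t‖ ^ 2 + δ ^ 2) ^ ((3 : ℝ) / 2))⁻¹
      + 3 * δ ^ 2 * ⟪x - X t, f t⟫ * (2 * (‖x - X t‖ ^ 2 + δ ^ 2) ^ ((5 : ℝ) / 2))⁻¹)

/-- The symmetric strain tensor `E(u) = (∇u + (∇u)ᵀ)/2` applied to the vector `n`. -/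
def strainApply (u : V3 → V3) (x n : V3) : V3 :=
  (2 : ℝ)⁻¹ • (fderiv ℝ u x n + gradient (fun y => ⟪u y, n⟫) x)

/-- The surface Jacobian `J_ε(s,θ) = ε(1 − ε(κ₁ cos θ + κ₂ sin θ))`. -/
def Jfac (X en1 en2 : ℝ → V3) (ε s θ : ℝ) : ℝ :=
  ε * (1 - ε * (⟪deriv (deriv X) s, en1 s⟫ * Real.cos θ
      + ⟪deriv (deriv X) s, en2 s⟫ * Real.sin θ))

/-- The regularized surface force density
`f^δ(s) = ∫_0^{2π} (2 E(u^δ) n − p^δ n) J_ε dθ`, with `n = −e_ρ`. -/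
def fReg (X en1 en2 f : ℝ → V3) (ε δ s : ℝ) : V3 :=
  ∫ θ in (0:ℝ)..(2 * Real.pi),
    Jfac X en1 en2 ε s θ •
      ((2 : ℝ) • strainApply (uReg X f ((ε ^ 2 + δ ^ 2) / 2) δ)
          (X s + ε • ePerp en1 en2 s θ) (-ePerp en1 en2 s θ)
        - pReg X f δ (X s + ε • ePerp en1 en2 s θ) • (-ePerp en1 en2 s θ))

/-- The vector field `d_n^δ[f](x)`. -/
def dReg (X f : ℝ → V3) (δ : ℝ) (n : ℕ) (x : V3) : V3 :=
  (8 * Real.pi)⁻¹ • ∫ t in (0:ℝ)..1,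
    (δ ^ 2 * ((‖x - X t‖ ^ 2 + δ ^ 2) ^ ((n : ℝ) / 2))⁻¹) • f t

/-- The scalar field `d_5^δ[f·R](x)`. -/
def dRegP (X f : ℝ → V3) (δ : ℝ) (x : V3) : ℝ :=
  (8 * Real.pi)⁻¹ * ∫ t in (0:ℝ)..1,
    δ ^ 2 * ⟪x - X t, f t⟫ * ((‖x - X t‖ ^ 2 + δ ^ 2) ^ ((5 : ℝ) / 2))⁻¹

/-- The extra force contribution
`F^δ(s) = ∫_0^{2π} (2E(d₃^δ[f])n − 3(ε²+δ²)E(d₅^δ[f])n − 3 d₅^δ[f·R] n) J_ε dθ`. -/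
def Fextra (X en1 en2 f : ℝ → V3) (ε δ s : ℝ) : V3 :=
  ∫ θ in (0:ℝ)..(2 * Real.pi),
    Jfac X en1 en2 ε s θ •
      ((2 : ℝ) • strainApply (dReg X f δ 3) (X s + ε • ePerp en1 en2 s θ)
          (-ePerp en1 en2 s θ)
        - (3 * (ε ^ 2 + δ ^ 2)) • strainApply (dReg X f δ 5)
            (X s + ε • ePerp en1 en2 s θ) (-ePerp en1 en2 s θ)
        - (3 * dRegP X f δ (X s + ε • ePerp en1 en2 s θ)) • (-ePerp en1 en2 s θ))

lemma abs_inv_pow_sub_inv_pow_le (k : ℕ) {m p q : ℝ} (hm : 0 < m) (hp : m ≤ p) (hq : m ≤ q) :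
    |(p ^ (k + 1))⁻¹ - (q ^ (k + 1))⁻¹| ≤ (k + 1) * |p - q| / m ^ (k + 2) := by
  have hp0 := hm.trans_le hp
  have hq0 := hm.trans_le hq
  rw [← inv_pow, ← inv_pow]
  refine (abs_pow_sub_pow_le _ _ _).trans ?_
  have h1 : |p⁻¹ - q⁻¹| ≤ |p - q| / m ^ 2 := by
    rw [inv_sub_inv hp0.ne' hq0.ne', abs_div, abs_sub_comm, abs_of_pos (mul_pos hp0 hq0), sq]
    gcongr
  have h2 : max |p⁻¹| |q⁻¹| ≤ m⁻¹ := by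
    rw [abs_of_pos (inv_pos.2 hp0), abs_of_pos (inv_pos.2 hq0)]
    exact max_le (by gcongr) (by gcongr)
  calc _ ≤ |p - q| / m ^ 2 * ((k + 1 : ℕ) : ℝ) * (m⁻¹) ^ (k + 1 - 1) := by gcongr
    _ = _ := by
      rw [Nat.cast_succ, add_tsub_cancel_right, pow_add m k 2, inv_pow]
      field_simp

lemma one_sub_div_sqrt_pow_le (j : ℕ) {σ η : ℝ} (hσ : 0 < σ) (hη : 0 ≤ η) :
    1 - (σ / √(σ ^ 2 + η ^ 2)) ^ j ≤ j * (η / √(σ ^ 2 + η ^ 2)) := by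
  set ρ := √(σ ^ 2 + η ^ 2)
  have hρ : 0 < ρ := Real.sqrt_pos.2 (by positivity)
  have hle : ρ ≤ σ + η := Real.sqrt_le_iff.2 ⟨by positivity, by nlinarith⟩
  have hb := one_add_mul_le_pow (a := σ / ρ - 1) (by linarith [div_pos hσ hρ]) j
  rw [add_sub_cancel] at hb
  have h1 : 1 - σ / ρ ≤ η / ρ := by
    rw [one_sub_div hρ.ne']
    gcongr
    linarith
  have : (j : ℝ) * (1 - σ / ρ) ≤ j * (η / ρ) := by gcongr
  linarith

lemma abs_inv_pow_sub_inv_sqrt_pow_sub_le (k : ℕ) {m u σ η : ℝ} (hm : 0 < m) (hu : m ≤ u)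
    (hσ : m ≤ σ) (hη : 0 ≤ η) :
    |((u ^ (k + 1))⁻¹ - (√(u ^ 2 + η ^ 2) ^ (k + 1))⁻¹)
        - ((σ ^ (k + 1))⁻¹ - (√(σ ^ 2 + η ^ 2) ^ (k + 1))⁻¹)|
      ≤ (k + 1) * (k + 3) * η / m ^ (k + 3) * |u - σ| := by
  have key := Convex.norm_image_sub_le_of_norm_hasDerivWithin_le (s := Set.Ici m)
    (f := fun x : ℝ => (x ^ (k + 1))⁻¹ - (√(x ^ 2 + η ^ 2) ^ (k + 1))⁻¹)
    (f' := fun x : ℝ => -((k + 1) * (x ^ (k + 2))⁻¹ * (1 - (x / √(x ^ 2 + η ^ 2)) ^ (k + 3))))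
    (C := (k + 1) * (k + 3) * η / m ^ (k + 3)) (x := σ) (y := u) ?_ ?_ (convex_Ici m) hσ hu
  · simpa only [Real.norm_eq_abs] using key
  · intro x hx
    have hx0 : 0 < x := hm.trans_le hx
    have hP : 0 < √(x ^ 2 + η ^ 2) := Real.sqrt_pos.2 (by positivity)
    have h1 : HasDerivAt (fun x : ℝ => √(x ^ 2 + η ^ 2)) (x / √(x ^ 2 + η ^ 2)) x := by
      convert ((hasDerivAt_pow 2 x).add_const (η ^ 2)).sqrt (by positivity) using 1
      push_cast
      field_simp
    have h2 := ((hasDerivAt_pow (k + 1) x).fun_inv (by positivity)).sub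
      ((h1.fun_pow (k + 1)).fun_inv (by positivity))
    refine (h2.congr_deriv ?_).hasDerivWithinAt
    rw [Nat.add_sub_cancel]
    generalize √(x ^ 2 + η ^ 2) = P at hP
    push_cast
    rw [div_pow]
    field_simp
    ring
  · intro x hx
    have hx0 : 0 < x := hm.trans_le hx
    have hP : 0 < √(x ^ 2 + η ^ 2) := Real.sqrt_pos.2 (by positivity)
    have hxP : x ≤ √(x ^ 2 + η ^ 2) := Real.le_sqrt_of_sq_le (by nlinarith)
    have h0 : 0 ≤ 1 - (x / √(x ^ 2 + η ^ 2)) ^ (k + 3) :=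
      sub_nonneg.2 (pow_le_one₀ (by positivity) ((div_le_one hP).2 hxP))
    have h1 := one_sub_div_sqrt_pow_le (k + 3) hx0 hη
    have h2 : η / √(x ^ 2 + η ^ 2) ≤ η / m := by
      gcongr
      exact (show m ≤ x from hx).trans hxP
    rw [norm_neg, Real.norm_of_nonneg (by positivity)]
    calc _ ≤ (k + 1 : ℝ) * (m ^ (k + 2))⁻¹ * (((k + 3 : ℕ) : ℝ) * (η / m)) := by
          gcongr
          · exact hx
          · exact h1.trans (by gcongr)
      _ = _ := by
        push_cast
        rw [pow_succ m (k + 2)]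
        field_simp

lemma hasDerivAt_log_add_sqrt {η : ℝ} (hη : 0 < η) (x : ℝ) :
    HasDerivAt (fun t : ℝ => Real.log (t + √(t ^ 2 + η ^ 2))) (√(x ^ 2 + η ^ 2))⁻¹ x := by
  have hP : 0 < √(x ^ 2 + η ^ 2) := Real.sqrt_pos.2 (by positivity)
  have hpos : 0 < x + √(x ^ 2 + η ^ 2) := by
    have : |x| < √(x ^ 2 + η ^ 2) := Real.lt_sqrt_of_sq_lt (by rw [sq_abs]; nlinarith)
    linarith [neg_abs_le x]
  have h1 := ((hasDerivAt_id x).add (((hasDerivAt_pow 2 x).add_const (η ^ 2)).sqrt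
    (by positivity))).log hpos.ne'
  refine h1.congr_deriv ?_
  simp only [Pi.add_apply, id_eq]
  generalize √(x ^ 2 + η ^ 2) = P at *
  have := hpos.ne'
  field_simp
  push_cast
  ring

lemma hasDerivAt_div_sqrt {η : ℝ} (hη : 0 < η) (x : ℝ) :
    HasDerivAt (fun t : ℝ => t / √(t ^ 2 + η ^ 2))
      ((√(x ^ 2 + η ^ 2))⁻¹ - x ^ 2 * (√(x ^ 2 + η ^ 2) ^ 3)⁻¹) x := by
  have hP : 0 < √(x ^ 2 + η ^ 2) := Real.sqrt_pos.2 (by positivity)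
  have h1 := (hasDerivAt_id x).fun_div (((hasDerivAt_pow 2 x).add_const (η ^ 2)).sqrt
    (by positivity)) hP.ne'
  refine h1.congr_deriv ?_
  generalize √(x ^ 2 + η ^ 2) = P at *
  simp only [id_eq]
  field_simp
  push_cast
  ring

lemma continuous_inv_sqrt_pow {η : ℝ} (hη : 0 < η) (j k : ℕ) :
    Continuous fun x : ℝ => x ^ j * (√(x ^ 2 + η ^ 2) ^ k)⁻¹ := by
  have : ∀ x : ℝ, √(x ^ 2 + η ^ 2) ^ k ≠ 0 := fun x =>
    pow_ne_zero _ (Real.sqrt_pos.2 (by positivity)).ne'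
  fun_prop (disch := assumption)

lemma abs_integral_inv_sqrt_add_log_le {η : ℝ} (hη : 0 < η) :
    |(∫ x in (-(1:ℝ)/2)..(1/2), (√(x ^ 2 + η ^ 2))⁻¹) + Real.log (η ^ 2)| ≤ 2 * η := by
  have hint : (∫ x in (-(1:ℝ)/2)..(1/2), (√(x ^ 2 + η ^ 2))⁻¹) = _ :=
    intervalIntegral.integral_eq_sub_of_hasDerivAt (fun x _ => hasDerivAt_log_add_sqrt hη x)
      (by simpa using (continuous_inv_sqrt_pow hη 0 1).intervalIntegrable _ _)
  rw [hint, show (-(1:ℝ)/2) ^ 2 = (1 / 2) ^ 2 by norm_num]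
  have hw2 : √((1 / 2 : ℝ) ^ 2 + η ^ 2) ^ 2 = (1 / 2) ^ 2 + η ^ 2 := Real.sq_sqrt (by positivity)
  have hw1 : 1 / 2 < √((1 / 2 : ℝ) ^ 2 + η ^ 2) := Real.lt_sqrt_of_sq_lt (by nlinarith)
  have hw3 : √((1 / 2 : ℝ) ^ 2 + η ^ 2) ≤ 1 / 2 + η :=
    Real.sqrt_le_iff.2 ⟨by positivity, by nlinarith⟩
  generalize √((1 / 2 : ℝ) ^ 2 + η ^ 2) = w at *
  have hη2 : Real.log (η ^ 2) = Real.log (1 / 2 + w) + Real.log (-1 / 2 + w) := by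
    rw [← Real.log_mul (by linarith) (by linarith)]
    congr 1
    linarith
  have h0 : 0 ≤ Real.log (1 / 2 + w) := Real.log_nonneg (by linarith)
  have h1 : Real.log (1 / 2 + w) ≤ η :=
    (Real.log_le_sub_one_of_pos (by linarith)).trans (by linarith)
  rw [hη2, abs_le]
  constructor <;> linarith

lemma abs_integral_sq_mul_inv_sqrt_cube_add_log_le {η : ℝ} (hη : 0 < η) :
    |(∫ x in (-(1:ℝ)/2)..(1/2), x ^ 2 * (√(x ^ 2 + η ^ 2) ^ 3)⁻¹) + Real.log (η ^ 2) + 2|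
      ≤ 6 * η := by
  have hi1 : IntervalIntegrable (fun x : ℝ => (√(x ^ 2 + η ^ 2))⁻¹) volume (-(1:ℝ)/2) (1/2) := by
    simpa using (continuous_inv_sqrt_pow hη 0 1).intervalIntegrable (-(1:ℝ)/2) (1/2)
  have hi3 := (continuous_inv_sqrt_pow hη 2 3).intervalIntegrable (μ := volume) (-(1:ℝ)/2) (1/2)
  have hint := intervalIntegral.integral_eq_sub_of_hasDerivAt
    (fun x (_ : x ∈ Set.uIcc (-(1:ℝ)/2) (1/2)) => hasDerivAt_div_sqrt hη x) (hi1.sub hi3)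
  rw [intervalIntegral.integral_sub hi1 hi3, show (-(1:ℝ)/2) ^ 2 = (1 / 2) ^ 2 by norm_num] at hint
  have hJ := abs_le.1 (abs_integral_inv_sqrt_add_log_le hη)
  have hw1 : 1 / 2 < √((1 / 2 : ℝ) ^ 2 + η ^ 2) := Real.lt_sqrt_of_sq_lt (by nlinarith)
  have hw3 : √((1 / 2 : ℝ) ^ 2 + η ^ 2) ≤ 1 / 2 + η :=
    Real.sqrt_le_iff.2 ⟨by positivity, by nlinarith⟩
  generalize √((1 / 2 : ℝ) ^ 2 + η ^ 2) = w at *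
  have e : (1 / 2) / w - (-1 / 2) / w = 1 / w := by ring
  have hu : 1 / w ≤ 2 := by rw [div_le_iff₀ (by linarith)]; linarith
  have hl : 2 - 4 * η ≤ 1 / w := by rw [le_div_iff₀ (by linarith)]; nlinarith
  rw [abs_le]
  constructor <;> linarith

lemma norm_le_C0norm {f : ℝ → V3} (hf : Continuous f) (hp : ∀ s, f (s + 1) = f s) (s : ℝ) :
    ‖f s‖ ≤ C0norm f := by
  have hper : Function.Periodic (fun s => ‖f s‖) 1 := fun s => by simp only [hp]
  exact le_ciSup (hper.compact_of_continuous one_ne_zero hf.norm).bddAbove s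

lemma norm_le_C1norm {g : ℝ → V3} (hg : ContDiff ℝ 1 g) (hp : ∀ s, g (s + 1) = g s) (s : ℝ) :
    ‖g s‖ ≤ C1norm g :=
  (norm_le_C0norm hg.continuous hp s).trans
    (le_add_of_nonneg_right (Real.iSup_nonneg fun _ => norm_nonneg _))

lemma norm_sub_zero_le_C1norm_mul {g : ℝ → V3} (hg : ContDiff ℝ 1 g)
    (hp : ∀ s, g (s + 1) = g s) (s : ℝ) : ‖g 0 - g s‖ ≤ C1norm g * |s| := by
  have hp' : ∀ t, deriv g (t + 1) = deriv g t := fun t => by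
    rw [← deriv_comp_add_const]
    simp only [hp]
  have hbd : ∀ t, ‖deriv g t‖ ≤ C1norm g := fun t =>
    (norm_le_C0norm (hg.continuous_deriv le_rfl) hp' t).trans
      (le_add_of_nonneg_left (Real.iSup_nonneg fun _ => norm_nonneg _))
  have h := convex_univ.norm_image_sub_le_of_norm_deriv_le (f := g)
    (fun x _ => hg.differentiable one_ne_zero x) (fun x _ => hbd x)
    (Set.mem_univ 0) (Set.mem_univ s)
  rw [norm_sub_rev]
  simpa using h

namespace SlenderGeom

variable {cΓ κmax : ℝ} {X en1 en2 : ℝ → V3}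

lemma hasDerivAt (h : SlenderGeom cΓ κmax X en1 en2) (t : ℝ) : HasDerivAt X (deriv X t) t :=
  (h.smooth.differentiable two_ne_zero t).hasDerivAt

lemma norm_deriv_sub_le (h : SlenderGeom cΓ κmax X en1 en2) (s t : ℝ) :
    ‖deriv X (s - t) - deriv X s‖ ≤ κmax * |t| := by
  have hd : Differentiable ℝ (deriv X) := by
    have h2 : ContDiff ℝ (1 + 1) X := by
      rw [one_add_one_eq_two]
      exact h.smooth
    exact (contDiff_succ_iff_deriv.1 h2).2.2.differentiable one_ne_zero
  have := convex_univ.norm_image_sub_le_of_norm_deriv_le (f := deriv X)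
    (fun x _ => hd x) (fun x _ => h.curvature_max x) (Set.mem_univ s) (Set.mem_univ (s - t))
  simpa using this

lemma hasDerivAt_remainder (h : SlenderGeom cΓ κmax X en1 en2) (s t : ℝ) :
    HasDerivAt (fun r => X s - X (s - r) - r • deriv X s) (deriv X (s - t) - deriv X s) t := by
  have h1 : HasDerivAt (fun r => X (s - r)) ((-1 : ℝ) • deriv X (s - t)) t :=
    (h.hasDerivAt (s - t)).scomp t ((hasDerivAt_id t).const_sub s)
  refine ((h1.const_sub (X s)).sub ((hasDerivAt_id t).smul_const (deriv X s))).congr_deriv ?_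
  simp

lemma norm_remainder_le (h : SlenderGeom cΓ κmax X en1 en2) (s t : ℝ) :
    ‖X s - X (s - t) - t • deriv X s‖ ≤ κmax * t ^ 2 := by
  have hκ : 0 ≤ κmax := (norm_nonneg _).trans (h.curvature_max 0)
  have key := (convex_uIcc 0 t).norm_image_sub_le_of_norm_hasDerivWithin_le
    (fun x _ => (h.hasDerivAt_remainder s x).hasDerivWithinAt) (C := κmax * |t|)
    (fun x hx => (h.norm_deriv_sub_le s x).trans ?_) Set.left_mem_uIcc Set.right_mem_uIcc
  · simpa [mul_assoc, ← sq] using key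
  · exact mul_le_mul_of_nonneg_left (by simpa using Set.abs_sub_left_of_mem_uIcc hx) hκ

lemma abs_inner_remainder_le (h : SlenderGeom cΓ κmax X en1 en2) (s t : ℝ) :
    |⟪deriv X s, X s - X (s - t) - t • deriv X s⟫| ≤ κmax ^ 2 * |t| ^ 3 / 2 := by
  have hκ : 0 ≤ κmax := (norm_nonneg _).trans (h.curvature_max 0)
  have key := (convex_uIcc 0 t).norm_image_sub_le_of_norm_hasDerivWithin_le
    (fun x _ => ((hasDerivAt_const x (deriv X s)).inner ℝ
      (h.hasDerivAt_remainder s x)).hasDerivWithinAt) (C := κmax ^ 2 * |t| ^ 2 / 2)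
    (fun x hx => ?_) Set.left_mem_uIcc Set.right_mem_uIcc
  · refine le_of_eq_of_le ?_ (key.trans_eq ?_)
    · simp
    · rw [sub_zero, Real.norm_eq_abs]
      ring
  · have hx' : |x| ≤ |t| := by simpa using Set.abs_sub_left_of_mem_uIcc hx
    have h1 : ‖deriv X (s - x) - deriv X s‖ ≤ κmax * |t| :=
      (h.norm_deriv_sub_le s x).trans (by gcongr)
    have h2 := @norm_add_sq_real V3 _ _ (deriv X s) (deriv X (s - x) - deriv X s)
    rw [add_sub_cancel, h.arclength, h.arclength] at h2
    have h3 : ‖deriv X (s - x) - deriv X s‖ ^ 2 ≤ (κmax * |t|) ^ 2 := by gcongr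
    have h4 : 0 ≤ ‖deriv X (s - x) - deriv X s‖ ^ 2 := by positivity
    rw [inner_zero_left, add_zero, Real.norm_eq_abs, abs_le]
    constructor <;> nlinarith

lemma abs_norm_sq_sub_le (h : SlenderGeom cΓ κmax X en1 en2) (s t : ℝ) :
    |‖X s - X (s - t)‖ ^ 2 - |t| ^ 2| ≤ 2 * κmax ^ 2 * |t| ^ 4 := by
  have hY := h.norm_remainder_le s t
  have hI := h.abs_inner_remainder_le s t
  have e := @norm_add_sq_real V3 _ _ (t • deriv X s) (X s - X (s - t) - t • deriv X s)
  rw [add_sub_cancel, norm_smul, h.arclength, inner_smul_left, mul_one, Real.norm_eq_abs] at e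
  generalize X s - X (s - t) - t • deriv X s = Y at *
  have h1 : ‖Y‖ ^ 2 ≤ (κmax * t ^ 2) ^ 2 := by gcongr
  have h2 : |t * ⟪deriv X s, Y⟫| ≤ |t| * (κmax ^ 2 * |t| ^ 3 / 2) := by
    rw [abs_mul]
    gcongr
  have h3 : 0 ≤ ‖Y‖ ^ 2 := by positivity
  rw [← sq_abs t] at h1
  simp only [conj_trivial] at e
  rw [e]
  have h2' := abs_le.1 h2
  have h5 : 0 ≤ κmax ^ 2 * |t| ^ 4 := by positivity
  rw [abs_le]
  constructor <;> nlinarith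

lemma norm_ePerp (h : SlenderGeom cΓ κmax X en1 en2) (s θ : ℝ) : ‖ePerp en1 en2 s θ‖ = 1 := by
  have e := @norm_add_sq_real V3 _ _ (Real.cos θ • en1 s) (Real.sin θ • en2 s)
  rw [inner_smul_left, inner_smul_right, h.en1_en2, norm_smul, norm_smul, h.en1_unit, h.en2_unit,
    mul_one, mul_one, Real.norm_eq_abs, Real.norm_eq_abs, sq_abs, sq_abs] at e
  have : ‖ePerp en1 en2 s θ‖ ^ 2 = 1 := by
    rw [ePerp, e]
    linarith [Real.cos_sq_add_sin_sq θ]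
  exact (pow_eq_one_iff_of_nonneg (norm_nonneg _) two_ne_zero).1 this

lemma abs_inner_ePerp_le (h : SlenderGeom cΓ κmax X en1 en2) (s t θ : ℝ) :
    |⟪X s - X (s - t), ePerp en1 en2 s θ⟫| ≤ κmax * t ^ 2 := by
  have e : ⟪X s - X (s - t), ePerp en1 en2 s θ⟫
      = ⟪X s - X (s - t) - t • deriv X s, ePerp en1 en2 s θ⟫ := by
    rw [inner_sub_left _ (t • _), inner_smul_left]
    simp [ePerp, inner_add_right, inner_smul_right, h.es_en1, h.es_en2]
  rw [e]
  refine (abs_real_inner_le_norm _ _).trans ?_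
  rw [h.norm_ePerp, mul_one]
  exact h.norm_remainder_le s t

lemma abs_norm_Rvec_sq_sub_le (h : SlenderGeom cΓ κmax X en1 en2) {ε : ℝ} (hε : 0 ≤ ε)
    (s t θ : ℝ) :
    |‖Rvec X en1 en2 ε s t θ‖ ^ 2 - (‖X s - X (s - t)‖ ^ 2 + ε ^ 2)|
      ≤ 2 * ε * (κmax * |t| ^ 2) := by
  have e := @norm_add_sq_real V3 _ _ (X s - X (s - t)) (ε • ePerp en1 en2 s θ)
  rw [norm_smul, h.norm_ePerp, mul_one, inner_smul_right, Real.norm_eq_abs, sq_abs] at e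
  have hR : Rvec X en1 en2 ε s t θ = X s - X (s - t) + ε • ePerp en1 en2 s θ := by
    rw [Rvec]
    abel
  rw [hR, e, sq_abs]
  have : ‖X s - X (s - t)‖ ^ 2 + 2 * (ε * ⟪X s - X (s - t), ePerp en1 en2 s θ⟫) + ε ^ 2
      - (‖X s - X (s - t)‖ ^ 2 + ε ^ 2) = 2 * ε * ⟪X s - X (s - t), ePerp en1 en2 s θ⟫ := by ring
  rw [this, abs_mul, abs_of_nonneg (by positivity)]
  gcongr
  exact h.abs_inner_ePerp_le s t θ

end SlenderGeom

/-- The constant in the pointwise bound for the kernel error of order `k + 1`. -/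
def kernelErrorConst (k : ℕ) (c K : ℝ) : ℝ :=
  (k + 1) * (2 * K / c) * (2 / c) ^ (k + 2) + 2 * K ^ 2 * (k + 1) * (k + 3) / c ^ (k + 3) + (k + 1)

lemma kernelErrorConst_nonneg (k : ℕ) {c K : ℝ} (hc : 0 < c) (hK : 0 ≤ K) :
    0 ≤ kernelErrorConst k c K := by
  unfold kernelErrorConst
  positivity

lemma pow_mul_abs_perturbed_kernel_sub_le (k : ℕ) {c K σ η u p : ℝ} (hc : 0 < c) (hK : 0 ≤ K)
    (hη : 0 < η) (hσ : 0 < σ) (hc1 : c ≤ 1) (hu : c * σ ≤ u) (hp : 0 < p)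
    (hpu : |p ^ 2 - (u ^ 2 + η ^ 2)| ≤ 2 * η * (K * σ ^ 2)) (hηK : 2 * η * K ≤ c ^ 2 / 2) :
    σ ^ k * |(p ^ (k + 1))⁻¹ - (√(u ^ 2 + η ^ 2) ^ (k + 1))⁻¹|
      ≤ (k + 1) * (2 * K / c) * (2 / c) ^ (k + 2) * (η * (√(σ ^ 2 + η ^ 2))⁻¹) := by
  have hρ : 0 < √(σ ^ 2 + η ^ 2) := Real.sqrt_pos.2 (by positivity)
  have hρ2 : √(σ ^ 2 + η ^ 2) ^ 2 = σ ^ 2 + η ^ 2 := Real.sq_sqrt (by positivity)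
  have hσρ : σ ≤ √(σ ^ 2 + η ^ 2) := Real.le_sqrt_of_sq_le (by nlinarith)
  have hq2 : √(u ^ 2 + η ^ 2) ^ 2 = u ^ 2 + η ^ 2 := Real.sq_sqrt (by positivity)
  have hq0 : 0 ≤ √(u ^ 2 + η ^ 2) := Real.sqrt_nonneg _
  rw [← hq2] at hpu
  generalize √(σ ^ 2 + η ^ 2) = ρ at *
  generalize √(u ^ 2 + η ^ 2) = q at *
  have hu2 : (c * σ) ^ 2 ≤ u ^ 2 := by gcongr
  have hcη : c ^ 2 * η ^ 2 ≤ 1 * η ^ 2 := by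
    gcongr
    exact pow_le_one₀ hc.le hc1
  have hq : c * ρ ≤ q := by
    refine le_of_sq_le_sq ?_ hq0
    nlinarith
  have hηKσ : 2 * η * K * σ ^ 2 ≤ c ^ 2 / 2 * σ ^ 2 := by gcongr
  have hpρ : c * ρ / 2 ≤ p := by
    refine le_of_sq_le_sq ?_ hp.le
    nlinarith [(abs_le.1 hpu).1, sq_nonneg (c * σ), sq_nonneg (c * η)]
  have hdiff : |p - q| ≤ 2 * η * (K * σ ^ 2) / (c * ρ) := by
    rw [le_div_iff₀ (by positivity)]
    calc |p - q| * (c * ρ) ≤ |p - q| * (p + q) := by gcongr; linarith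
      _ = |p ^ 2 - q ^ 2| := by
        rw [sq_sub_sq, abs_mul, abs_of_nonneg (by positivity : 0 ≤ p + q), mul_comm]
      _ ≤ _ := hpu
  calc _ ≤ σ ^ k * ((k + 1) * |p - q| / (c * ρ / 2) ^ (k + 2)) := by
        gcongr
        exact abs_inv_pow_sub_inv_pow_le k (by positivity) hpρ
          (by linarith [mul_pos hc hρ])
    _ ≤ σ ^ k * ((k + 1) * (2 * η * (K * σ ^ 2) / (c * ρ)) / (c * ρ / 2) ^ (k + 2)) := by gcongr
    _ = (k + 1) * (2 * K / c) * (2 / c) ^ (k + 2) * (η * ρ⁻¹) * (σ / ρ) ^ (k + 2) := by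
        rw [div_pow _ _ (k + 2), div_pow _ _ (k + 2), div_pow _ _ (k + 2), mul_pow c ρ]
        field_simp
        ring
    _ ≤ _ := mul_le_of_le_one_right (by positivity)
        (pow_le_one₀ (by positivity) ((div_le_one hρ).2 hσρ))

lemma norm_kernel_error_le (k : ℕ) {c K σ η u p G : ℝ} {v v₀ : V3} (hc : 0 < c) (hc1 : c ≤ 1)
    (hK : 0 ≤ K) (hη : 0 < η) (hσ : 0 < σ) (hση : σ ^ 2 + η ^ 2 ≤ 1) (hu : c * σ ≤ u)
    (huσ : |u ^ 2 - σ ^ 2| ≤ 2 * K ^ 2 * σ ^ 4) (hp : 0 < p)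
    (hpu : |p ^ 2 - (u ^ 2 + η ^ 2)| ≤ 2 * η * (K * σ ^ 2)) (hηK : 2 * η * K ≤ c ^ 2 / 2)
    (hv : ‖v‖ ≤ G) (hv₀ : ‖v₀ - v‖ ≤ G * σ) :
    ‖(σ ^ k * (p ^ (k + 1))⁻¹) • v - ((σ ^ k * (u ^ (k + 1))⁻¹) • v - σ⁻¹ • v₀)
        - (σ ^ k * (√(σ ^ 2 + η ^ 2) ^ (k + 1))⁻¹) • v₀‖
      ≤ kernelErrorConst k c K * G * (η * (√(σ ^ 2 + η ^ 2))⁻¹) := by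
  have h1 := pow_mul_abs_perturbed_kernel_sub_le k hc hK hη hσ hc1 hu hp hpu hηK
  have h2 := abs_inv_pow_sub_inv_sqrt_pow_sub_le k (mul_pos hc hσ) hu
    (by nlinarith : c * σ ≤ σ) hη.le
  have h3 := one_sub_div_sqrt_pow_le (k + 1) hσ hη.le
  have hG : 0 ≤ G := (norm_nonneg _).trans hv
  have hρ : 0 < √(σ ^ 2 + η ^ 2) := Real.sqrt_pos.2 (by positivity)
  have hρ1 : √(σ ^ 2 + η ^ 2) ≤ 1 := Real.sqrt_le_one.2 hση
  have hσρ : σ ≤ √(σ ^ 2 + η ^ 2) := Real.le_sqrt_of_sq_le (by nlinarith)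
  generalize √(σ ^ 2 + η ^ 2) = ρ at *
  generalize √(u ^ 2 + η ^ 2) = q at *
  have hu0 : 0 < u := (mul_pos hc hσ).trans_le hu
  have hdiff : |u - σ| ≤ 2 * K ^ 2 * σ ^ 3 := by
    refine le_of_mul_le_mul_right ?_ hσ
    calc |u - σ| * σ ≤ |u - σ| * (u + σ) := by gcongr; linarith
      _ = |u ^ 2 - σ ^ 2| := by
        rw [sq_sub_sq, abs_mul, abs_of_pos (by positivity : 0 < u + σ), mul_comm]
      _ ≤ 2 * K ^ 2 * σ ^ 4 := huσ
      _ = _ := by ring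
  have hηρ : η ≤ η * ρ⁻¹ := le_mul_of_one_le_right hη.le ((one_le_inv₀ hρ).2 hρ1)
  have h2' : σ ^ k * |((u ^ (k + 1))⁻¹ - (q ^ (k + 1))⁻¹) - ((σ ^ (k + 1))⁻¹ - (ρ ^ (k + 1))⁻¹)|
      ≤ 2 * K ^ 2 * (k + 1) * (k + 3) / c ^ (k + 3) * (η * ρ⁻¹) := by
    calc _ ≤ σ ^ k * ((k + 1) * (k + 3) * η / (c * σ) ^ (k + 3) * (2 * K ^ 2 * σ ^ 3)) := by
          gcongr
          exact h2.trans (by gcongr)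
      _ = 2 * K ^ 2 * (k + 1) * (k + 3) / c ^ (k + 3) * η := by
          rw [mul_pow, pow_add σ k 3]
          field_simp
      _ ≤ _ := by gcongr
  have h3' : |σ⁻¹ - σ ^ k * (ρ ^ (k + 1))⁻¹| * σ ≤ (k + 1) * (η * ρ⁻¹) := by
    have e : (σ⁻¹ - σ ^ k * (ρ ^ (k + 1))⁻¹) * σ = 1 - (σ / ρ) ^ (k + 1) := by
      rw [div_pow, pow_succ σ]
      field_simp
    have h0 : 0 ≤ 1 - (σ / ρ) ^ (k + 1) :=
      sub_nonneg.2 (pow_le_one₀ (by positivity) ((div_le_one hρ).2 hσρ))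
    rw [← abs_of_pos hσ, ← abs_mul, abs_of_pos hσ, e, abs_of_nonneg h0]
    simpa [div_eq_mul_inv] using h3
  have split : (σ ^ k * (p ^ (k + 1))⁻¹) • v - ((σ ^ k * (u ^ (k + 1))⁻¹) • v - σ⁻¹ • v₀)
        - (σ ^ k * (ρ ^ (k + 1))⁻¹) • v₀
      = (σ ^ k * ((p ^ (k + 1))⁻¹ - (q ^ (k + 1))⁻¹)) • v
        - (σ ^ k * (((u ^ (k + 1))⁻¹ - (q ^ (k + 1))⁻¹)
            - ((σ ^ (k + 1))⁻¹ - (ρ ^ (k + 1))⁻¹))) • v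
        + (σ⁻¹ - σ ^ k * (ρ ^ (k + 1))⁻¹) • (v₀ - v) := by
    have : σ ^ k * (σ ^ (k + 1))⁻¹ = σ⁻¹ := by
      rw [pow_succ]
      field_simp
    rw [← this]
    module
  rw [split]
  refine (norm_add_le_of_le (norm_sub_le _ _) le_rfl).trans ?_
  rw [norm_smul, norm_smul, norm_smul, Real.norm_eq_abs, Real.norm_eq_abs, Real.norm_eq_abs,
    abs_mul, abs_mul, abs_of_pos (pow_pos hσ k)]
  calc _ ≤ (k + 1) * (2 * K / c) * (2 / c) ^ (k + 2) * (η * ρ⁻¹) * G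
        + 2 * K ^ 2 * (k + 1) * (k + 3) / c ^ (k + 3) * (η * ρ⁻¹) * G
        + |σ⁻¹ - σ ^ k * (ρ ^ (k + 1))⁻¹| * (G * σ) := by gcongr
    _ = (k + 1) * (2 * K / c) * (2 / c) ^ (k + 2) * (η * ρ⁻¹) * G
        + 2 * K ^ 2 * (k + 1) * (k + 3) / c ^ (k + 3) * (η * ρ⁻¹) * G
        + |σ⁻¹ - σ ^ k * (ρ ^ (k + 1))⁻¹| * σ * G := by ring
    _ ≤ (k + 1) * (2 * K / c) * (2 / c) ^ (k + 2) * (η * ρ⁻¹) * G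
        + 2 * K ^ 2 * (k + 1) * (k + 3) / c ^ (k + 3) * (η * ρ⁻¹) * G
        + (k + 1) * (η * ρ⁻¹) * G := by gcongr
    _ = _ := by
      unfold kernelErrorConst
      ring

lemma abs_integral_model_kernel_add_log_le {k : ℕ} (hk : k = 0 ∨ k = 2) {η : ℝ} (hη : 0 < η) :
    |(∫ x in (-(1:ℝ)/2)..(1/2), x ^ k * (√(x ^ 2 + η ^ 2) ^ (k + 1))⁻¹) + Real.log (η ^ 2) + k|
      ≤ 6 * η := by
  rcases hk with rfl | rfl
  · have h := abs_integral_inv_sqrt_add_log_le hη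
    simp only [pow_zero, one_mul, zero_add, pow_one, Nat.cast_zero, add_zero]
    linarith
  · exact_mod_cast abs_integral_sq_mul_inv_sqrt_cube_add_log_le hη

lemma norm_integral_sub_add_log_smul_le {k : ℕ} (hk : k = 0 ∨ k = 2) {η M G : ℝ} {v₀ : V3}
    {A B : ℝ → V3} (hη : 0 < η) (hη4 : η ^ 2 ≤ 1 / 8) (hM : 0 ≤ M) (hv₀ : ‖v₀‖ ≤ G)
    (hA : Continuous A) (hB : Measurable B)
    (hAB : ∀ x : ℝ, x ≠ 0 → |x| ≤ 1 / 2 →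
      ‖A x - B x - (x ^ k * (√(x ^ 2 + η ^ 2) ^ (k + 1))⁻¹) • v₀‖
        ≤ M * G * (η * (√(x ^ 2 + η ^ 2))⁻¹)) :
    ‖(∫ x in (-(1:ℝ)/2)..(1/2), A x) - (∫ x in (-(1:ℝ)/2)..(1/2), B x)
        + Real.log (η ^ 2) • v₀ + (k : ℝ) • v₀‖
      ≤ (2 * M + 6) * G * η * |Real.log (η ^ 2)| := by
  have hG : 0 ≤ G := (norm_nonneg _).trans hv₀
  have hker := continuous_inv_sqrt_pow hη k (k + 1)
  have hinv : Continuous fun x : ℝ => (√(x ^ 2 + η ^ 2))⁻¹ := by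
    simpa using continuous_inv_sqrt_pow hη 0 1
  have hbd : ∀ᵐ x : ℝ, x ∈ Set.Ioc (-(1:ℝ)/2) (1/2) →
      ‖A x - B x - (x ^ k * (√(x ^ 2 + η ^ 2) ^ (k + 1))⁻¹) • v₀‖
        ≤ M * G * (η * (√(x ^ 2 + η ^ 2))⁻¹) := by
    filter_upwards [Measure.ae_ne volume (0 : ℝ)] with x hx hmem
    exact hAB x hx (abs_le.2 ⟨by linarith [hmem.1], hmem.2⟩)
  have hgint : IntervalIntegrable (fun x : ℝ => M * G * (η * (√(x ^ 2 + η ^ 2))⁻¹)) volume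
      (-(1:ℝ)/2) (1/2) := (by fun_prop : Continuous _).intervalIntegrable _ _
  have hAi : IntervalIntegrable A volume (-(1:ℝ)/2) (1/2) := hA.intervalIntegrable _ _
  have hKi : IntervalIntegrable (fun x : ℝ => (x ^ k * (√(x ^ 2 + η ^ 2) ^ (k + 1))⁻¹) • v₀)
      volume (-(1:ℝ)/2) (1/2) := (hker.smul continuous_const).intervalIntegrable _ _
  have hFi : IntervalIntegrable
      (fun x => A x - B x - (x ^ k * (√(x ^ 2 + η ^ 2) ^ (k + 1))⁻¹) • v₀)
      volume (-(1:ℝ)/2) (1/2) := by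
    refine hgint.mono_fun' ?_ ?_
    · exact ((hA.measurable.sub hB).sub
        (hker.smul continuous_const).measurable).aestronglyMeasurable
    · rw [Set.uIoc_of_le (by norm_num)]
      exact (ae_restrict_iff' measurableSet_Ioc).2 hbd
  have hBi : IntervalIntegrable B volume (-(1:ℝ)/2) (1/2) := by
    refine ((hAi.sub hKi).sub hFi).congr (fun x _ => ?_)
    abel
  have hF := intervalIntegral.norm_integral_le_of_norm_le (by norm_num) hbd hgint
  rw [intervalIntegral.integral_const_mul, intervalIntegral.integral_const_mul] at hF
  have hI := intervalIntegral.integral_sub (hAi.sub hBi) hKi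
  rw [intervalIntegral.integral_sub hAi hBi, intervalIntegral.integral_smul_const] at hI
  have hJ := (abs_le.1 (abs_integral_inv_sqrt_add_log_le hη)).2
  have hmodel := abs_integral_model_kernel_add_log_le hk hη
  have hη1 : 2 * η ≤ 1 := by nlinarith
  have hlog : 1 ≤ |Real.log (η ^ 2)| := by
    have h1 : Real.log (η ^ 2) ≤ Real.log (Real.exp (-1)) := by
      refine Real.log_le_log (by positivity) (hη4.trans ?_)
      rw [Real.exp_neg, ← one_div]
      gcongr
      linarith [Real.exp_one_lt_d9]
    rw [Real.log_exp] at h1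
    rw [le_abs]
    right
    linarith
  have hJ' : (∫ x in (-(1:ℝ)/2)..(1/2), (√(x ^ 2 + η ^ 2))⁻¹) ≤ 2 * |Real.log (η ^ 2)| := by
    linarith [neg_abs_le (Real.log (η ^ 2))]
  have e : (∫ x in (-(1:ℝ)/2)..(1/2), A x) - (∫ x in (-(1:ℝ)/2)..(1/2), B x)
        + Real.log (η ^ 2) • v₀ + (k : ℝ) • v₀
      = (∫ x in (-(1:ℝ)/2)..(1/2), A x - B x
          - (x ^ k * (√(x ^ 2 + η ^ 2) ^ (k + 1))⁻¹) • v₀)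
        + ((∫ x in (-(1:ℝ)/2)..(1/2), x ^ k * (√(x ^ 2 + η ^ 2) ^ (k + 1))⁻¹)
          + Real.log (η ^ 2) + k) • v₀ := by
    rw [hI]
    module
  rw [e]
  refine (norm_add_le _ _).trans ?_
  rw [norm_smul, Real.norm_eq_abs]
  calc _ ≤ M * G * (η * (2 * |Real.log (η ^ 2)|)) + 6 * η * G := by
        gcongr
        exact hF.trans (by gcongr)
    _ ≤ M * G * (η * (2 * |Real.log (η ^ 2)|)) + 6 * η * G * |Real.log (η ^ 2)| := by
        exact add_le_add le_rfl (le_mul_of_one_le_right (by positivity) hlog)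
    _ = _ := by ring

/-- Logarithmic asymptotics for the critical kernel integrals (`n = 1` or
`n = 3`): the regularized integral equals the renormalized singular integral minus
`g(0) log(ε²+δ²) − (n−1) g(0)`, up to `C ‖g‖_{C¹} √(ε²+δ²) |log(ε²+δ²)|`. -/
theorem kernel_integral_critical_asymptotics (n : ℕ) (hn : n = 1 ∨ n = 3)
    (cΓ κmax : ℝ) (hcΓ : 0 < cΓ) :
    ∃ C > 0, ∃ ε₀ > 0,
      ∀ X en1 en2 : ℝ → V3, SlenderGeom cΓ κmax X en1 en2 →
      ∀ g : ℝ → V3, ContDiff ℝ 1 g → (∀ s, g (s + 1) = g s) →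
      ∀ ε δ : ℝ, 0 < ε → ε < ε₀ → 0 < δ → δ < ε₀ →
      ∀ s θ : ℝ,
        ‖(∫ sb in (-(1:ℝ)/2)..(1/2),
              (sb ^ (n - 1) * ((‖Rvec X en1 en2 ε s sb θ‖ ^ 2 + δ ^ 2) ^ ((n : ℝ) / 2))⁻¹)
                • g sb)
            - (∫ sb in (-(1:ℝ)/2)..(1/2),
                ((sb ^ (n - 1) * (‖X s - X (s - sb)‖ ^ n)⁻¹) • g sb - |sb|⁻¹ • g 0))
            + Real.log (ε ^ 2 + δ ^ 2) • g 0 + ((n : ℝ) - 1) • g 0‖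
          ≤ C * C1norm g * (ε ^ 2 + δ ^ 2) ^ ((1 : ℝ) / 2)
              * |Real.log (ε ^ 2 + δ ^ 2)| := by
  obtain ⟨k, rfl, hk⟩ : ∃ k, n = k + 1 ∧ (k = 0 ∨ k = 2) := by
    rcases hn with rfl | rfl
    exacts [⟨0, rfl, Or.inl rfl⟩, ⟨2, rfl, Or.inr rfl⟩]
  have hkeven : Even k := by rcases hk with rfl | rfl <;> decide
  set c := min cΓ 1
  have hc : 0 < c := lt_min hcΓ one_pos
  have hc1 : c ≤ 1 := min_le_right _ _
  have hM := kernelErrorConst_nonneg k hc (abs_nonneg κmax)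
  refine ⟨2 * kernelErrorConst k c |κmax| + 6, by positivity,
    min (1 / 4) (c ^ 2 / (8 * (|κmax| + 1))), by positivity, ?_⟩
  intro X en1 en2 h g hg hgp ε δ hε hε₀ hδ hδ₀ s θ
  have hκ0 : 0 ≤ κmax := (norm_nonneg _).trans (h.curvature_max 0)
  rw [abs_of_nonneg hκ0] at hM hε₀ hδ₀ ⊢
  obtain ⟨hε4, hεκ⟩ := lt_min_iff.1 hε₀
  obtain ⟨hδ4, hδκ⟩ := lt_min_iff.1 hδ₀
  rw [lt_div_iff₀ (by positivity)] at hεκ hδκ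
  have hη : 0 < √(ε ^ 2 + δ ^ 2) := Real.sqrt_pos.2 (by positivity)
  have hη2 : √(ε ^ 2 + δ ^ 2) ^ 2 = ε ^ 2 + δ ^ 2 := Real.sq_sqrt (by positivity)
  have hεη : ε ≤ √(ε ^ 2 + δ ^ 2) := Real.le_sqrt_of_sq_le (by nlinarith)
  have hηle : √(ε ^ 2 + δ ^ 2) ≤ ε + δ := Real.sqrt_le_iff.2 ⟨by positivity, by nlinarith⟩
  rw [← Real.sqrt_eq_rpow, ← hη2, Real.sqrt_sq hη.le]
  generalize √(ε ^ 2 + δ ^ 2) = η at *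
  have hη8 : η ^ 2 ≤ 1 / 8 := by nlinarith
  have hηK : 2 * η * κmax ≤ c ^ 2 / 2 := by nlinarith
  have hX := h.smooth.continuous
  have hpos : ∀ x : ℝ, 0 < ‖Rvec X en1 en2 ε s x θ‖ ^ 2 + δ ^ 2 := fun x => by positivity
  have hcast : ((k + 1 : ℕ) : ℝ) - 1 = k := by
    push_cast
    ring
  simp only [Real.rpow_div_two_eq_sqrt _ (hpos _).le, Real.rpow_natCast, Nat.add_sub_cancel, hcast]
  refine norm_integral_sub_add_log_smul_le hk hη hη8 hM (norm_le_C1norm hg hgp 0) ?_ ?_ ?_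
  · have hR : Continuous fun x => Rvec X en1 en2 ε s x θ := by
      unfold Rvec
      fun_prop
    have hne : ∀ x, √(‖Rvec X en1 en2 ε s x θ‖ ^ 2 + δ ^ 2) ^ (k + 1) ≠ 0 := fun x =>
      pow_ne_zero _ (Real.sqrt_pos.2 (hpos x)).ne'
    have := hg.continuous
    fun_prop (disch := assumption)
  · have h1 : Measurable fun x => ‖X s - X (s - x)‖ := by fun_prop
    have h2 : Measurable g := hg.continuous.measurable
    have h3 : Measurable fun x : ℝ => |x|⁻¹ := by fun_prop
    fun_prop
  · intro x hx hx2
    have hxsq : |x| ^ 2 ≤ (1 / 2) ^ 2 := by gcongr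
    have hRsq := h.abs_norm_Rvec_sq_sub_le hε.le s x θ
    have hmain := norm_kernel_error_le k (σ := |x|) (u := ‖X s - X (s - x)‖)
      (p := √(‖Rvec X en1 en2 ε s x θ‖ ^ 2 + δ ^ 2)) (v := g x) (v₀ := g 0) hc hc1 hκ0 hη
      (abs_pos.2 hx) (by linarith) ?_ (h.abs_norm_sq_sub_le s x) (Real.sqrt_pos.2 (hpos x)) ?_ hηK
      (norm_le_C1norm hg hgp x) (norm_sub_zero_le_C1norm_mul hg hgp x)
    · rwa [hkeven.pow_abs, sq_abs] at hmain
    · have hinj := h.no_self_intersect s (s - x) (by rwa [sub_sub_cancel])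
      rw [sub_sub_cancel] at hinj
      exact (mul_le_mul_of_nonneg_right (min_le_left _ _) (abs_nonneg x)).trans hinj
    · rw [Real.sq_sqrt (hpos x).le, hη2]
      refine le_trans (le_of_eq_of_le (congrArg abs ?_) hRsq) (by gcongr)
      ring
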